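/- arXiv:1802.04399 — 4 statements merged into one kernel-verified Lean document; each statement's English description precedes it below -/
import Mathlib

section
/- Let A be an N×K complex matrix with columns a_1,…,a_K, let ρ ∈ ℂ^K be a vector whose support is T with |T| = M and M < N. For q = 1,…,ℵ let Λ_q be a K×K diagonal complex matrix, set b_q := A Λ_q ρ, and let B be the N×ℵ matrix whose q-th column is b_q. Assume that every set of M+1 columns of A is linearly independent and that rank(B) = M. Then for each k ∈ {1,…,K}, the column a_k lies in the column space of B if and only if k ∈ T. -/
open Matrix

/-- If `D` is diagonal, `A D v` lies in the span of the columns of `A` indexed by any set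
containing the support of `v`. -/
theorem Matrix.IsDiag.mulVec_mulVec_mem_span {R m n : Type*} [CommSemiring R] [Fintype n]
    {D : Matrix n n R} (hD : D.IsDiag) (A : Matrix m n R) {v : n → R} {s : Set n}
    (hv : ∀ k, v k ≠ 0 → k ∈ s) :
    A *ᵥ (D *ᵥ v) ∈ Submodule.span R (A.col '' s) := by
  classical
  rw [← hD.diagonal_diag, mulVec_eq_sum]
  refine Submodule.sum_mem _ fun k _ => ?_
  by_cases hk : v k = 0
  · simp [mulVec_diagonal, hk]
  · rw [op_smul_eq_smul]
    exact Submodule.smul_mem _ _ (Submodule.subset_span (Set.mem_image_of_mem A.col (hv k hk)))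

/-- Exact-recovery statement underlying Proposition 1 (MUSIC): with noiseless MMV data
`b_q = A Λ_q ρ` (`Λ_q` diagonal), support `T` of `ρ` of size `M < N`, every `M+1` columns
of `A` linearly independent and `rank B = M`, a column `a_k` of `A` lies in the column
space of `B` iff `k ∈ T`. -/
theorem music_exact_support {N K M ℵ : ℕ}
    (A : Matrix (Fin N) (Fin K) ℂ) (ρ : Fin K → ℂ)
    (T : Finset (Fin K)) (hT : T = Finset.univ.filter fun k => ρ k ≠ 0)
    (hTM : T.card = M) (hMN : M < N)
    (Λ : Fin ℵ → Matrix (Fin K) (Fin K) ℂ) (hΛ : ∀ q, (Λ q).IsDiag)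
    (B : Matrix (Fin N) (Fin ℵ) ℂ)
    (hB : ∀ q n, B n q = (A *ᵥ (Λ q *ᵥ ρ)) n)
    (hindep : ∀ s : Finset (Fin K), s.card = M + 1 →
      LinearIndependent ℂ (fun i : {x // x ∈ s} => Aᵀ i.val))
    (hrank : B.rank = M) :
    ∀ k : Fin K, Aᵀ k ∈ LinearMap.range B.mulVecLin ↔ k ∈ T := by
  have hle : LinearMap.range B.mulVecLin ≤ Submodule.span ℂ (A.col '' (T : Set (Fin K))) := by
    rw [range_mulVecLin, Submodule.span_le]
    rintro _ ⟨q, rfl⟩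
    have hcol : B.col q = A *ᵥ (Λ q *ᵥ ρ) := funext (hB q)
    rw [hcol]
    exact (hΛ q).mulVec_mulVec_mem_span A fun k hk => by simp [hT, hk]
  have hdim : Module.finrank ℂ (Submodule.span ℂ (A.col '' (T : Set (Fin K)))) ≤ M := by
    classical
    rw [← Finset.coe_image, ← hTM]
    exact (finrank_span_finset_le_card _).trans Finset.card_image_le
  have hrange : LinearMap.range B.mulVecLin = Submodule.span ℂ (A.col '' (T : Set (Fin K))) :=
    Submodule.eq_of_le_of_finrank_le hle (hdim.trans_eq hrank.symm)
  intro k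
  change A.col k ∈ _ ↔ _
  rw [hrange]
  refine ⟨fun hk => ?_, fun hk => Submodule.subset_span (Set.mem_image_of_mem A.col hk)⟩
  by_contra hkT
  have hli : LinearIndepOn ℂ A.col ((insert k T : Finset (Fin K)) : Set (Fin K)) :=
    hindep (insert k T) (by rw [Finset.card_insert_of_notMem hkT, hTM])
  rw [Finset.coe_insert, linearIndepOn_insert (by simpa using hkT)] at hli
  exact hli.2 hk
end

section
/- Let T be a finite index set with |T| = M ≥ 2, let a_i ∈ ℂ^N for i ∈ T satisfy ‖a_i‖ = 1 for all i ∈ T and |⟨a_i, a_j⟩| < ε/(M−1) for all distinct i, j ∈ T, where 0 < ε < 1/3. Then for every z of the form z = Σ_{i∈T} α_i a_i with α_i ∈ ℂ, one has (1−2ε)² ‖z‖² ≤ Σ_{j∈T} |⟨a_j, z⟩|² ≤ (1+2ε)² ‖z‖². -/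
open scoped InnerProductSpace

section NearlyOrthonormal

variable {𝕜 E ι : Type*} [RCLike 𝕜] [NormedAddCommGroup E] [InnerProductSpace 𝕜 E] [Fintype ι]

/-- The quadratic form of the Gram matrix of a family of unit vectors with pairwise inner products
at most `δ` differs from the identity by at most `δ * (card ι - 1)`. -/
lemma abs_norm_sum_smul_sq_sub_le {a : ι → E} {δ : ℝ} (hnorm : ∀ i, ‖a i‖ = 1)
    (hortho : ∀ i j, i ≠ j → ‖⟪a i, a j⟫_𝕜‖ ≤ δ) (β : ι → 𝕜) :
    |‖∑ i, β i • a i‖ ^ 2 - ∑ i, ‖β i‖ ^ 2| ≤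
      δ * ((Fintype.card ι : ℝ) - 1) * ∑ i, ‖β i‖ ^ 2 := by
  classical
  have expand : ‖∑ i, β i • a i‖ ^ 2 = ∑ i, ∑ j, RCLike.re ⟪β i • a i, β j • a j⟫_𝕜 := by
    rw [← inner_self_eq_norm_sq (𝕜 := 𝕜), sum_inner, map_sum]
    refine Finset.sum_congr rfl fun i _ => ?_
    rw [inner_sum, map_sum]
  have diag : ∑ i, ‖β i‖ ^ 2 = ∑ i, ∑ j, if i = j then ‖β i‖ ^ 2 else 0 := by simp
  have entry (i j : ι) : |RCLike.re ⟪β i • a i, β j • a j⟫_𝕜 - if i = j then ‖β i‖ ^ 2 else 0| ≤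
      δ / 2 * (‖β i‖ ^ 2 + ‖β j‖ ^ 2) - if i = j then δ * ‖β i‖ ^ 2 else 0 := by
    rcases eq_or_ne i j with rfl | hij
    · rw [if_pos rfl, if_pos rfl, inner_self_eq_norm_sq, norm_smul, hnorm, mul_one, sub_self,
        abs_zero]
      exact le_of_eq (by ring)
    · rw [if_neg hij, if_neg hij, sub_zero, sub_zero]
      have hδ : 0 ≤ δ := (norm_nonneg _).trans (hortho i j hij)
      calc |RCLike.re ⟪β i • a i, β j • a j⟫_𝕜| ≤ ‖⟪β i • a i, β j • a j⟫_𝕜‖ :=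
            RCLike.abs_re_le_norm _
        _ = ‖β i‖ * ‖β j‖ * ‖⟪a i, a j⟫_𝕜‖ := by
            rw [inner_smul_left, inner_smul_right, norm_mul, norm_mul, RCLike.norm_conj, mul_assoc]
        _ ≤ ‖β i‖ * ‖β j‖ * δ := by gcongr; exact hortho i j hij
        _ ≤ δ / 2 * (‖β i‖ ^ 2 + ‖β j‖ ^ 2) := by
            nlinarith [mul_nonneg hδ (sq_nonneg (‖β i‖ - ‖β j‖))]
  calc |‖∑ i, β i • a i‖ ^ 2 - ∑ i, ‖β i‖ ^ 2|
      = |∑ i, ∑ j, (RCLike.re ⟪β i • a i, β j • a j⟫_𝕜 - if i = j then ‖β i‖ ^ 2 else 0)| := by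
        rw [expand, diag]
        simp only [Finset.sum_sub_distrib]
    _ ≤ ∑ i, ∑ j, (δ / 2 * (‖β i‖ ^ 2 + ‖β j‖ ^ 2) - if i = j then δ * ‖β i‖ ^ 2 else 0) :=
        (Finset.abs_sum_le_sum_abs _ _).trans <| Finset.sum_le_sum fun i _ =>
          (Finset.abs_sum_le_sum_abs _ _).trans <| Finset.sum_le_sum fun j _ => entry i j
    _ = δ * ((Fintype.card ι : ℝ) - 1) * ∑ i, ‖β i‖ ^ 2 := by
        simp only [Finset.sum_sub_distrib, ← Finset.mul_sum, Finset.sum_add_distrib,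
          Finset.sum_const, Finset.card_univ, nsmul_eq_mul, Finset.sum_ite_eq, Finset.mem_univ,
          if_true]
        ring

/-- An upper Riesz bound is an upper frame bound. -/
lemma sum_norm_inner_sq_le_of_norm_sum_smul_sq_le {a : ι → E} {C : ℝ} (hC : 0 ≤ C)
    (h : ∀ β : ι → 𝕜, ‖∑ i, β i • a i‖ ^ 2 ≤ C * ∑ i, ‖β i‖ ^ 2) (z : E) :
    ∑ j, ‖⟪a j, z⟫_𝕜‖ ^ 2 ≤ C * ‖z‖ ^ 2 := by
  set S := ∑ j, ‖⟪a j, z⟫_𝕜‖ ^ 2 with hS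
  have hS0 : 0 ≤ S := by positivity
  have key : ⟪∑ j, ⟪a j, z⟫_𝕜 • a j, z⟫_𝕜 = (S : 𝕜) := by
    rw [sum_inner, hS]
    push_cast
    refine Finset.sum_congr rfl fun j _ => ?_
    rw [inner_smul_left, RCLike.conj_mul]
  have cs : S ≤ ‖∑ j, ⟪a j, z⟫_𝕜 • a j‖ * ‖z‖ := by
    have := norm_inner_le_norm (𝕜 := 𝕜) (∑ j, ⟪a j, z⟫_𝕜 • a j) z
    rwa [key, RCLike.norm_ofReal, abs_of_nonneg hS0] at this
  have hsq : S * S ≤ C * ‖z‖ ^ 2 * S := by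
    calc S * S ≤ (‖∑ j, ⟪a j, z⟫_𝕜 • a j‖ * ‖z‖) * (‖∑ j, ⟪a j, z⟫_𝕜 • a j‖ * ‖z‖) :=
          mul_self_le_mul_self hS0 cs
      _ = ‖∑ j, ⟪a j, z⟫_𝕜 • a j‖ ^ 2 * ‖z‖ ^ 2 := by ring
      _ ≤ (C * S) * ‖z‖ ^ 2 := by gcongr; exact h _
      _ = C * ‖z‖ ^ 2 * S := by ring
  rcases hS0.eq_or_lt with h0 | hpos
  · rw [← h0]; positivity
  · exact le_of_mul_le_mul_right hsq hpos

/-- A lower Riesz bound is a lower frame bound on the span. -/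
lemma le_sum_norm_inner_sq_of_le_norm_sum_smul_sq {a : ι → E} {c : ℝ} (hc : 0 ≤ c) (α : ι → 𝕜)
    (h : c * ∑ i, ‖α i‖ ^ 2 ≤ ‖∑ i, α i • a i‖ ^ 2) :
    c * ‖∑ i, α i • a i‖ ^ 2 ≤ ∑ j, ‖⟪a j, ∑ i, α i • a i⟫_𝕜‖ ^ 2 := by
  set z := ∑ i, α i • a i with hz
  set S := ∑ j, ‖⟪a j, z⟫_𝕜‖ ^ 2
  have hS0 : 0 ≤ S := by positivity
  have cs : ‖z‖ ^ 2 ≤ ∑ i, ‖α i‖ * ‖⟪a i, z⟫_𝕜‖ := by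
    calc ‖z‖ ^ 2 = ‖⟪z, z⟫_𝕜‖ := by
          rw [inner_self_eq_norm_sq_to_K, norm_pow, RCLike.norm_ofReal, abs_norm]
      _ = ‖∑ i, ⟪α i • a i, z⟫_𝕜‖ := by rw [← sum_inner, ← hz]
      _ ≤ ∑ i, ‖⟪α i • a i, z⟫_𝕜‖ := norm_sum_le _ _
      _ = ∑ i, ‖α i‖ * ‖⟪a i, z⟫_𝕜‖ := by
          simp only [inner_smul_left, norm_mul, RCLike.norm_conj]
  have hsq : c * ‖z‖ ^ 2 * ‖z‖ ^ 2 ≤ S * ‖z‖ ^ 2 := by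
    calc c * ‖z‖ ^ 2 * ‖z‖ ^ 2 = c * (‖z‖ ^ 2) ^ 2 := by ring
      _ ≤ c * (∑ i, ‖α i‖ * ‖⟪a i, z⟫_𝕜‖) ^ 2 := by gcongr
      _ ≤ c * ((∑ i, ‖α i‖ ^ 2) * S) := by gcongr; exact Finset.sum_mul_sq_le_sq_mul_sq _ _ _
      _ = (c * ∑ i, ‖α i‖ ^ 2) * S := by ring
      _ ≤ ‖z‖ ^ 2 * S := by gcongr
      _ = S * ‖z‖ ^ 2 := mul_comm _ _
  rcases (sq_nonneg ‖z‖).eq_or_lt with h0 | hpos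
  · rw [← h0, mul_zero]; exact hS0
  · exact le_of_mul_le_mul_right hsq hpos

end NearlyOrthonormal

/-- The key frame-type estimate (claim (yo_yo)) in the proof of Theorem 2: if the `a_i`,
`i ∈ T`, `|T| = M ≥ 2`, are unit vectors with pairwise inner products `< ε/(M−1)` where
`0 < ε < 1/3`, then for every `z = Σ_{i∈T} α_i a_i` one has
`(1−2ε)²‖z‖² ≤ Σ_{j∈T} |⟨a_j, z⟩|² ≤ (1+2ε)²‖z‖²`. -/
theorem music_frame_estimate {N : ℕ} {ι : Type*} [Fintype ι] {M : ℕ} (hM : 2 ≤ M)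
    (hcard : Fintype.card ι = M) (a : ι → EuclideanSpace ℂ (Fin N))
    (ε : ℝ) (hε0 : 0 < ε) (hε : ε < 1 / 3)
    (hnorm : ∀ i, ‖a i‖ = 1)
    (hortho : ∀ i j, i ≠ j → ‖⟪a i, a j⟫_ℂ‖ < ε / ((M : ℝ) - 1)) :
    ∀ α : ι → ℂ,
      (1 - 2 * ε) ^ 2 * ‖∑ i, α i • a i‖ ^ 2 ≤
          ∑ j, ‖⟪a j, ∑ i, α i • a i⟫_ℂ‖ ^ 2 ∧
        ∑ j, ‖⟪a j, ∑ i, α i • a i⟫_ℂ‖ ^ 2 ≤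
          (1 + 2 * ε) ^ 2 * ‖∑ i, α i • a i‖ ^ 2 := by
  have hM1 : (0 : ℝ) < (M : ℝ) - 1 := by
    have : (2 : ℝ) ≤ M := by exact_mod_cast hM
    linarith
  have riesz (β : ι → ℂ) : |‖∑ i, β i • a i‖ ^ 2 - ∑ i, ‖β i‖ ^ 2| ≤ ε * ∑ i, ‖β i‖ ^ 2 := by
    have := abs_norm_sum_smul_sq_sub_le hnorm (fun i j hij => (hortho i j hij).le) β
    rwa [hcard, div_mul_cancel₀ _ hM1.ne'] at this
  intro α
  constructor
  · refine le_trans ?_ (le_sum_norm_inner_sq_of_le_norm_sum_smul_sq (c := 1 - ε) (by linarith) α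
      (by linarith [(abs_le.mp (riesz α)).1]))
    gcongr
    nlinarith
  · refine (sum_norm_inner_sq_le_of_norm_sum_smul_sq_le (C := 1 + ε) (by linarith)
      (fun β => by linarith [(abs_le.mp (riesz β)).2]) _).trans ?_
    gcongr
    nlinarith
end

section
/- Let T be a finite index set with |T| = M ≥ 2, let a_i ∈ ℂ^N for i ∈ T satisfy ‖a_i‖ = 1 for all i ∈ T and |⟨a_i, a_j⟩| < ε/(M−1) for all distinct i, j ∈ T, where 0 < ε < 1/3. Then for every z of the form z = Σ_{i∈T} α_i a_i with α_i ∈ ℂ, one has ((1 − 2ε − ε²)/(1 + ε)) ‖z‖² ≤ Σ_{j∈T} |⟨a_j, z⟩|² ≤ ((1 + ε)²/(1 − ε)) ‖z‖². -/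
open scoped InnerProductSpace

section GramVector

variable {𝕜 E ι : Type*} [RCLike 𝕜] [NormedAddCommGroup E] [InnerProductSpace 𝕜 E] [Fintype ι]

/-- The vector of inner products of the `a j` with a combination of the `a i` pairs with the
coefficient vector to the squared norm of the combination. -/
theorem inner_coeff_analysis (a : ι → E) (α : ι → 𝕜) :
    ⟪WithLp.toLp 2 α, WithLp.toLp 2 (fun j => ⟪a j, ∑ i, α i • a i⟫_𝕜)⟫_𝕜 =
      ((‖∑ i, α i • a i‖ ^ 2 : ℝ) : 𝕜) := by
  have h := inner_self_eq_norm_sq_to_K (𝕜 := 𝕜) (∑ i, α i • a i)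
  rw [sum_inner] at h
  push_cast
  rw [← h, PiLp.inner_apply]
  exact Finset.sum_congr rfl fun j _ => by
    rw [inner_smul_left, RCLike.inner_apply, mul_comm]

/-- For unit vectors with pairwise inner products at most `δ`, the Gram matrix differs from the
identity by at most `(|ι| - 1) δ` in operator norm. -/
theorem norm_analysis_sub_coeff_le (a : ι → E) (hnorm : ∀ i, ‖a i‖ = 1) {δ : ℝ}
    (hδ : 0 ≤ δ) (hortho : ∀ i j, i ≠ j → ‖⟪a i, a j⟫_𝕜‖ ≤ δ)
    (hcard : 1 ≤ Fintype.card ι) (α : ι → 𝕜) :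
    ‖WithLp.toLp 2 (fun j => ⟪a j, ∑ i, α i • a i⟫_𝕜) - WithLp.toLp 2 α‖ ≤
      ((Fintype.card ι : ℝ) - 1) * δ * ‖WithLp.toLp 2 α‖ := by
  classical
  set m : ℝ := (Fintype.card ι : ℝ) - 1 with hm
  have hm0 : 0 ≤ m := by
    have : (1 : ℝ) ≤ Fintype.card ι := by exact_mod_cast hcard
    linarith
  have hcoord (j : ι) : ‖⟪a j, ∑ i, α i • a i⟫_𝕜 - α j‖ ≤
      δ * ∑ i ∈ Finset.univ.erase j, ‖α i‖ := by
    have h : ⟪a j, ∑ i, α i • a i⟫_𝕜 - α j =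
        ∑ i ∈ Finset.univ.erase j, α i * ⟪a j, a i⟫_𝕜 := by
      simp only [inner_sum, inner_smul_right]
      rw [← Finset.add_sum_erase _ _ (Finset.mem_univ j), inner_self_eq_norm_sq_to_K, hnorm]
      simp
    rw [h, Finset.mul_sum]
    refine norm_sum_le_of_le _ fun i hi => ?_
    rw [norm_mul, mul_comm]
    gcongr
    exact hortho j i (Finset.ne_of_mem_erase hi).symm
  have hsq (j : ι) : ‖⟪a j, ∑ i, α i • a i⟫_𝕜 - α j‖ ^ 2 ≤
      δ ^ 2 * (m * (∑ i, ‖α i‖ ^ 2 - ‖α j‖ ^ 2)) := by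
    have hc : ((Finset.univ.erase j).card : ℝ) = m := by
      rw [Finset.card_erase_of_mem (Finset.mem_univ j), Finset.card_univ, Nat.cast_sub hcard,
        hm, Nat.cast_one]
    have hs := sq_sum_le_card_mul_sum_sq (s := Finset.univ.erase j) (f := fun i => ‖α i‖)
    rw [hc, Finset.sum_erase_eq_sub (f := fun i => ‖α i‖ ^ 2) (Finset.mem_univ j)] at hs
    calc _ ≤ (δ * ∑ i ∈ Finset.univ.erase j, ‖α i‖) ^ 2 := by gcongr; exact hcoord j
      _ ≤ _ := by rw [mul_pow]; gcongr
  refine le_of_sq_le_sq ?_ (by positivity)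
  rw [mul_pow, EuclideanSpace.norm_sq_eq, EuclideanSpace.norm_sq_eq]
  refine (Finset.sum_le_sum fun j _ => hsq j).trans_eq ?_
  rw [← Finset.mul_sum, ← Finset.mul_sum, Finset.sum_sub_distrib, Finset.sum_const,
    Finset.card_univ, nsmul_eq_mul, hm]
  ring

end GramVector

/-- The intermediate two-sided estimate in the proof of Theorem 2: if the `a_i`, `i ∈ T`,
`|T| = M ≥ 2`, are unit vectors with pairwise inner products `< ε/(M−1)`, `0 < ε < 1/3`,
then for `z = Σ_{i∈T} α_i a_i`,
`((1−2ε−ε²)/(1+ε))‖z‖² ≤ Σ_{j∈T} |⟨a_j, z⟩|² ≤ ((1+ε)²/(1−ε))‖z‖²`. -/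
theorem music_intermediate_estimate {N : ℕ} {ι : Type*} [Fintype ι] {M : ℕ} (hM : 2 ≤ M)
    (hcard : Fintype.card ι = M) (a : ι → EuclideanSpace ℂ (Fin N))
    (ε : ℝ) (hε0 : 0 < ε) (hε : ε < 1 / 3)
    (hnorm : ∀ i, ‖a i‖ = 1)
    (hortho : ∀ i j, i ≠ j → ‖⟪a i, a j⟫_ℂ‖ < ε / ((M : ℝ) - 1)) :
    ∀ α : ι → ℂ,
      ((1 - 2 * ε - ε ^ 2) / (1 + ε)) * ‖∑ i, α i • a i‖ ^ 2 ≤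
          ∑ j, ‖⟪a j, ∑ i, α i • a i⟫_ℂ‖ ^ 2 ∧
        ∑ j, ‖⟪a j, ∑ i, α i • a i⟫_ℂ‖ ^ 2 ≤
          ((1 + ε) ^ 2 / (1 - ε)) * ‖∑ i, α i • a i‖ ^ 2 := by
  intro α
  have hM' : (2 : ℝ) ≤ M := by exact_mod_cast hM
  have hM0 : (0 : ℝ) < (M : ℝ) - 1 := by linarith
  have hdiff := norm_analysis_sub_coeff_le a hnorm (by positivity : 0 ≤ ε / ((M : ℝ) - 1))
    (fun i j hij => (hortho i j hij).le) (by omega) α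
  rw [hcard, mul_div_cancel₀ _ hM0.ne'] at hdiff
  have hinner := inner_coeff_analysis a α
  have hB := EuclideanSpace.norm_sq_eq
    (WithLp.toLp 2 (fun j => ⟪a j, ∑ i, α i • a i⟫_ℂ))
  simp only at hB
  rw [← hB]
  set A : EuclideanSpace ℂ ι := WithLp.toLp 2 α
  set B : EuclideanSpace ℂ ι := WithLp.toLp 2 (fun j => ⟪a j, ∑ i, α i • a i⟫_ℂ)
  set z := ∑ i, α i • a i
  have hcs : |‖z‖ ^ 2 - ‖A‖ ^ 2| ≤ ε * ‖A‖ ^ 2 := by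
    have h : ⟪A, B - A⟫_ℂ = ((‖z‖ ^ 2 - ‖A‖ ^ 2 : ℝ) : ℂ) := by
      rw [inner_sub_right, hinner, inner_self_eq_norm_sq_to_K]
      push_cast
      rfl
    calc |‖z‖ ^ 2 - ‖A‖ ^ 2| = ‖⟪A, B - A⟫_ℂ‖ := by rw [h, Complex.norm_real, Real.norm_eq_abs]
      _ ≤ ‖A‖ * ‖B - A‖ := norm_inner_le_norm _ _
      _ ≤ ‖A‖ * (ε * ‖A‖) := by gcongr
      _ = ε * ‖A‖ ^ 2 := by ring
  obtain ⟨hlow, hupp⟩ := abs_le.mp hcs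
  obtain ⟨hBA, hAB⟩ := abs_le.mp ((abs_norm_sub_norm_le B A).trans hdiff)
  have hε1 : 0 < 1 - ε := by linarith
  have hBupp : ‖B‖ ^ 2 ≤ (1 + ε) ^ 2 * ‖A‖ ^ 2 := by
    rw [← mul_pow]
    gcongr
    linarith
  have hBlow : (1 - ε) ^ 2 * ‖A‖ ^ 2 ≤ ‖B‖ ^ 2 := by
    rw [← mul_pow]
    gcongr
    linarith
  constructor
  · rw [div_mul_eq_mul_div, div_le_iff₀ (by positivity)]
    have hc : 0 ≤ 1 - 2 * ε - ε ^ 2 := by nlinarith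
    calc (1 - 2 * ε - ε ^ 2) * ‖z‖ ^ 2
        ≤ (1 - 2 * ε - ε ^ 2) * ((1 + ε) * ‖A‖ ^ 2) := by gcongr; linarith
      _ ≤ (1 - ε) ^ 2 * ((1 + ε) * ‖A‖ ^ 2) := by gcongr; nlinarith
      _ = (1 - ε) ^ 2 * ‖A‖ ^ 2 * (1 + ε) := by ring
      _ ≤ ‖B‖ ^ 2 * (1 + ε) := by gcongr
  · rw [div_mul_eq_mul_div, le_div_iff₀ hε1]
    calc ‖B‖ ^ 2 * (1 - ε) ≤ (1 + ε) ^ 2 * ‖A‖ ^ 2 * (1 - ε) := by gcongr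
      _ = (1 + ε) ^ 2 * ((1 - ε) * ‖A‖ ^ 2) := by ring
      _ ≤ (1 + ε) ^ 2 * ‖z‖ ^ 2 := by gcongr; linarith
end

section
/- Let L > 0 and η ∈ ℝ with L + η > 0, and let r ≥ 0. Then | √(r² + (L+η)²) − (L+η) − r²/(2L) | ≤ r⁴/(8(L+η)³) + r² |η| / (2 L (L+η)). -/
/-- Second-order Taylor estimate for `√(r² + d²)` around `r = 0`. -/
theorem abs_sqrt_sq_add_sq_sub_le (d r : ℝ) (hd : 0 < d) :
    |Real.sqrt (r ^ 2 + d ^ 2) - d - r ^ 2 / (2 * d)| ≤ r ^ 4 / (8 * d ^ 3) := by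
  obtain ⟨u, hu⟩ : ∃ u, u = Real.sqrt (r ^ 2 + d ^ 2) - d := ⟨_, rfl⟩
  have hu0 : 0 ≤ u := by
    rw [hu, sub_nonneg]
    exact Real.le_sqrt_of_sq_le (by nlinarith [sq_nonneg r])
  have hr2 : r ^ 2 = u * (u + 2 * d) := by
    have h := Real.sq_sqrt (by positivity : 0 ≤ r ^ 2 + d ^ 2)
    rw [show Real.sqrt (r ^ 2 + d ^ 2) = u + d by linarith] at h
    linarith
  have hlin : u - r ^ 2 / (2 * d) = -(u ^ 2 / (2 * d)) := by
    rw [hr2]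
    field_simp
    ring
  have hr4 : r ^ 4 / (8 * d ^ 3) = (u + u ^ 2 / (2 * d)) ^ 2 / (2 * d) := by
    rw [show r ^ 4 = (r ^ 2) ^ 2 by ring, hr2]
    field_simp
    ring
  rw [← hu, hlin, abs_neg, abs_of_nonneg (by positivity), hr4]
  gcongr
  exact le_add_of_nonneg_right (by positivity)

/-- Quantitative paraxial phase-error estimate: for `L > 0`, `L + η > 0` and `r ≥ 0`,
`|√(r² + (L+η)²) − (L+η) − r²/(2L)| ≤ r⁴/(8(L+η)³) + r²|η|/(2L(L+η))`. -/
theorem paraxial_distance_approx (L η r : ℝ) (hL : 0 < L) (hLη : 0 < L + η) (hr : 0 ≤ r) :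
    |Real.sqrt (r ^ 2 + (L + η) ^ 2) - (L + η) - r ^ 2 / (2 * L)| ≤
      r ^ 4 / (8 * (L + η) ^ 3) + r ^ 2 * |η| / (2 * L * (L + η)) := by
  have hshift : |r ^ 2 / (2 * (L + η)) - r ^ 2 / (2 * L)| =
      r ^ 2 * |η| / (2 * L * (L + η)) := by
    have h : r ^ 2 / (2 * (L + η)) - r ^ 2 / (2 * L) =
        -(r ^ 2 * η / (2 * L * (L + η))) := by
      field_simp
      ring
    rw [h, abs_neg, abs_div, abs_mul, abs_of_nonneg (sq_nonneg r),
      abs_of_pos (by positivity : 0 < 2 * L * (L + η))]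
  rw [← hshift]
  exact (abs_sub_le _ (r ^ 2 / (2 * (L + η))) _).trans
    (add_le_add_left (abs_sqrt_sq_add_sq_sub_le (L + η) r hLη) _)
end
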